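/- arXiv:2306.03151 — 2 statements merged into one kernel-verified Lean document; each statement's English description precedes it below -/
import Mathlib

section
/- (Claim 1: conditional unbiasedness of k-DISCount) Let s_1, ..., s_n be i.i.d. from ḡ_Ω, let n(S) = |{i : s_i ∈ S}|, and define F̂(S) = G(S) · (1/n(S)) Σ_{i : s_i ∈ S} f(s_i)/g(s_i) when n(S) > 0 and F̂(S) = 0 when n(S) = 0. Then E[F̂(S) | n(S) > 0] = F(S); more precisely, E[F̂(S) | n(S) = m] = F(S) for every m ∈ {1, ..., n} with P[n(S) = m] > 0. -/
open Finset Filter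

noncomputable section

variable {Ω : Type*} [Fintype Ω] [DecidableEq Ω]

/-- Expectation of `X : (Fin n → Ω) → ℝ` under `n` i.i.d. samples drawn from the
pmf `q` on the finite type `Ω` (the `n`-fold product measure). -/
noncomputable def iidExp (n : ℕ) (q : Ω → ℝ) (X : (Fin n → Ω) → ℝ) : ℝ :=
  ∑ v : Fin n → Ω, (∏ i, q (v i)) * X v

/-- Probability of the event `P` under `n` i.i.d. samples drawn from the pmf `q`. -/
noncomputable def iidPr (n : ℕ) (q : Ω → ℝ) (P : (Fin n → Ω) → Prop) [DecidablePred P] : ℝ :=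
  iidExp n q fun v => if P v then 1 else 0

/-- Variance of `X` under `n` i.i.d. samples drawn from the pmf `q`. -/
noncomputable def iidVar (n : ℕ) (q : Ω → ℝ) (X : (Fin n → Ω) → ℝ) : ℝ :=
  iidExp n q fun v => (X v - iidExp n q X) ^ 2

/-- `n(S)`: the number of the samples `v 0, …, v (n-1)` that land in `S`. -/
def nIn (S : Finset Ω) {n : ℕ} (v : Fin n → Ω) : ℕ :=
  (Finset.univ.filter fun i => v i ∈ S).card

/-- The `k`-DISCount estimator `F̂(S)`: equal to
`G(S) · (1/n(S)) · ∑_{i : sᵢ ∈ S} f(sᵢ)/g(sᵢ)` if `n(S) > 0`, and `0` otherwise. -/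
noncomputable def kdis (S : Finset Ω) (f g : Ω → ℝ) {n : ℕ} (v : Fin n → Ω) : ℝ :=
  if 0 < nIn S v then
    (∑ s ∈ S, g s) *
      ((nIn S v : ℝ)⁻¹ * ∑ i ∈ Finset.univ.filter (fun i => v i ∈ S), f (v i) / g (v i))
  else 0

theorem nIn_update {α : Type*} [DecidableEq α] {S : Finset α} {n : ℕ} {v : Fin n → α} {i : Fin n}
    {s : α}
    (hv : v i ∈ S) (hs : s ∈ S) : nIn S (Function.update v i s) = nIn S v := by
  unfold nIn
  congr 1
  refine Finset.filter_congr fun j _ => ?_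
  by_cases h : j = i
  · subst h
    simp [hv, hs]
  · simp [Function.update_of_ne h]

theorem prod_update_mul {α ι : Type*} [Fintype ι] [DecidableEq ι] (q : α → ℝ) (v : ι → α)
    (i : ι) (s : α) : (∏ j, q (Function.update v i s j)) * q (v i) = (∏ j, q (v j)) * q s := by
  rw [← Finset.mul_prod_erase univ (fun j => q (Function.update v i s j)) (mem_univ i),
    ← Finset.mul_prod_erase univ (fun j => q (v j)) (mem_univ i)]
  have h : ∏ j ∈ univ.erase i, q (Function.update v i s j) = ∏ j ∈ univ.erase i, q (v j) :=
    Finset.prod_congr rfl fun j hj => by rw [Function.update_of_ne (Finset.ne_of_mem_erase hj)]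
  rw [h]
  simp only [Function.update_self]
  ring

/-- Resampling the `i`-th coordinate inside `S` preserves the distribution of the sample and
`n(S)`. -/
theorem sum_exchange (S : Finset Ω) (q h : Ω → ℝ) (w : ℕ → ℝ) {n : ℕ} (i : Fin n) :
    (∑ s ∈ S, q s) *
        ∑ v : Fin n → Ω with v i ∈ S, (∏ j, q (v j)) * w (nIn S v) * h (v i) =
      (∑ s ∈ S, q s * h s) * ∑ v : Fin n → Ω with v i ∈ S, (∏ j, q (v j)) * w (nIn S v) := by
  rw [Finset.sum_mul_sum, Finset.sum_mul_sum, ← Finset.sum_product', ← Finset.sum_product']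
  refine Finset.sum_nbij' (fun p => (p.2 i, Function.update p.2 i p.1))
    (fun p => (p.2 i, Function.update p.2 i p.1)) ?_ ?_ ?_ ?_ ?_
  · rintro ⟨s, v⟩ hp
    simp_all
  · rintro ⟨s, v⟩ hp
    simp_all
  · rintro ⟨s, v⟩ _
    simp
  · rintro ⟨s, v⟩ _
    simp
  · rintro ⟨s, v⟩ hp
    simp only [mem_product, mem_filter, mem_univ, true_and] at hp
    simp only [nIn_update hp.2 hp.1]
    linear_combination (-(w (nIn S v) * h (v i))) * prod_update_mul q v i s

theorem iidExp_sum_mem (S : Finset Ω) (q h : Ω → ℝ) (w : ℕ → ℝ) (n : ℕ) :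
    (∑ s ∈ S, q s) *
        iidExp n q (fun v => w (nIn S v) * ∑ i with v i ∈ S, h (v i)) =
      (∑ s ∈ S, q s * h s) * iidExp n q (fun v => w (nIn S v) * nIn S v) := by
  have key (h : Ω → ℝ) : iidExp n q (fun v => w (nIn S v) * ∑ i with v i ∈ S, h (v i)) =
      ∑ i, ∑ v : Fin n → Ω with v i ∈ S, (∏ j, q (v j)) * w (nIn S v) * h (v i) := by
    simp only [iidExp, Finset.sum_filter, Finset.mul_sum]
    rw [Finset.sum_comm]
    simp only [mul_ite, mul_zero, mul_assoc]
  have hcard : iidExp n q (fun v => w (nIn S v) * nIn S v) =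
      ∑ i, ∑ v : Fin n → Ω with v i ∈ S, (∏ j, q (v j)) * w (nIn S v) := by
    simpa [nIn] using key fun _ => 1
  rw [key, hcard, Finset.mul_sum, Finset.mul_sum]
  exact Finset.sum_congr rfl fun i _ => sum_exchange S q h w i

theorem iidExp_kdis_mul_ite (S : Finset Ω) (f g : Ω → ℝ) (hg : ∀ s, 0 < g s) (n : ℕ)
    (P : ℕ → Prop) [DecidablePred P] (hP : ∀ k, P k → 0 < k) :
    iidExp n (fun s => g s / ∑ t, g t) (fun v => kdis S f g v * if P (nIn S v) then 1 else 0) =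
      (∑ s ∈ S, f s) * iidPr n (fun s => g s / ∑ t, g t) (fun v => P (nIn S v)) := by
  rcases isEmpty_or_nonempty Ω with hΩ | hΩ
  · simp [kdis, iidExp, Finset.eq_empty_of_isEmpty S]
  have hG : ∑ t, g t ≠ 0 := (Finset.sum_pos (fun s _ => hg s) univ_nonempty).ne'
  have hmain := iidExp_sum_mem S (fun s => g s / ∑ t, g t) (fun s => f s / g s)
    (fun k => if P k then (k : ℝ)⁻¹ else 0) n
  have hF : ∑ s ∈ S, g s / (∑ t, g t) * (f s / g s) = (∑ s ∈ S, f s) / ∑ t, g t := by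
    rw [Finset.sum_div]
    refine Finset.sum_congr rfl fun s _ => ?_
    have := (hg s).ne'
    field_simp
  have hk (k : ℕ) : (if P k then (k : ℝ)⁻¹ else 0) * k = if P k then 1 else 0 := by
    split_ifs with h
    · exact inv_mul_cancel₀ (Nat.cast_ne_zero.mpr (hP k h).ne')
    · exact zero_mul _
  rw [hF, ← Finset.sum_div, div_mul_eq_mul_div, div_mul_eq_mul_div, div_left_inj' hG] at hmain
  simp only [hk] at hmain
  rw [iidPr, ← hmain]
  simp only [iidExp, Finset.mul_sum (univ : Finset (Fin n → Ω))]
  refine Finset.sum_congr rfl fun v _ => ?_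
  by_cases h : P (nIn S v)
  · simp only [kdis, h, hP _ h, if_true]
    ring
  · simp [h]

theorem iidPr_nIn_pos {S : Finset Ω} (hS : S.Nonempty) {q : Ω → ℝ} (hq : ∀ s, 0 < q s) {n : ℕ}
    (hn : 0 < n) : 0 < iidPr n q (fun v => 0 < nIn S v) := by
  obtain ⟨s, hs⟩ := hS
  refine Finset.sum_pos' (fun v _ => ?_) ⟨fun _ => s, mem_univ _, ?_⟩
  · exact mul_nonneg (Finset.prod_nonneg fun i _ => (hq _).le) (by dsimp only; split_ifs <;> norm_num)
  · simpa [nIn, hs, hn] using pow_pos (hq s) n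

/-- **Claim 1: conditional unbiasedness of k-DISCount.**
With `s₁, …, sₙ` i.i.d. from `ḡ_Ω`, `n(S) = |{i : sᵢ ∈ S}|`, and `F̂(S)` the
k-DISCount estimator, we have `E[F̂(S) | n(S) > 0] = F(S)`; more precisely,
`E[F̂(S) | n(S) = m] = F(S)` for every `m ∈ {1, …, n}` with `P[n(S) = m] > 0`. -/
theorem kdiscount_conditionally_unbiased
    (S : Finset Ω) (hS : S.Nonempty) (f g : Ω → ℝ)
    (hf : ∀ s, 0 ≤ f s) (hg : ∀ s, 0 < g s)
    (n : ℕ) (hn : 0 < n) (q : Ω → ℝ) (hq : q = fun s => g s / ∑ t, g t) :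
    (iidExp n q (fun v => kdis S f g v * if 0 < nIn S v then 1 else 0) /
        iidPr n q (fun v => 0 < nIn S v) = ∑ s ∈ S, f s) ∧
    (∀ m : ℕ, 1 ≤ m → m ≤ n → 0 < iidPr n q (fun v => nIn S v = m) →
      iidExp n q (fun v => kdis S f g v * if nIn S v = m then 1 else 0) /
          iidPr n q (fun v => nIn S v = m) = ∑ s ∈ S, f s) := by
  subst hq
  constructor
  · have hq (s : Ω) : 0 < g s / ∑ t, g t :=
      div_pos (hg s) (Finset.sum_pos (fun t _ => hg t) ⟨s, mem_univ s⟩)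
    rw [iidExp_kdis_mul_ite S f g hg n (fun k => 0 < k) fun _ h => h]
    exact mul_div_cancel_right₀ _ (iidPr_nIn_pos hS hq hn).ne'
  · intro m hm _ hpos
    rw [iidExp_kdis_mul_ite S f g hg n (fun k => k = m) fun _ h => h ▸ hm]
    exact mul_div_cancel_right₀ _ hpos.ne'
end
end

section
/- (Bias of k-DISCount) With F̂(S) the k-DISCount estimator based on n i.i.d. samples from ḡ_Ω and p(S) = G(S)/G(Ω), the unconditional expectation satisfies E[F̂(S)] = (1 − (1 − p(S))^n) · F(S); equivalently, the bias is E[F̂(S)] − F(S) = −F(S) · (1 − p(S))^n. -/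
open Finset Filter

noncomputable section

variable {Ω : Type*} [Fintype Ω] [DecidableEq Ω]

theorem nIn_insertNth {Ω : Type*} [DecidableEq Ω] (S : Finset Ω) {n : ℕ} (i : Fin (n + 1))
    (x : Ω) (w : Fin n → Ω) :
    nIn S (i.insertNth x w : Fin (n + 1) → Ω) = (if x ∈ S then 1 else 0) + nIn S w := by
  simp only [nIn, Finset.card_filter]
  rw [Fin.sum_univ_succAbove _ i]
  simp

/-- If `k` has `q`-mean zero on `S`, then weighting `k` at one sample by `1 / n(S)` on the event
that this sample lies in `S` gives expectation zero. -/
theorem iidExp_inv_nIn_mul_eq_zero {Ω : Type*} [Fintype Ω] [DecidableEq Ω] (S : Finset Ω)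
    (q k : Ω → ℝ) (hk : ∑ x ∈ S, q x * k x = 0) {n : ℕ} (i : Fin n) :
    iidExp n q (fun v => (nIn S v : ℝ)⁻¹ * if v i ∈ S then k (v i) else 0) = 0 := by
  obtain _ | n := n
  · exact i.elim0
  unfold iidExp
  rw [← (Fin.insertNthEquiv (fun _ => Ω) i).sum_comp, Fintype.sum_prod_type_right]
  refine Finset.sum_eq_zero fun w _ => ?_
  calc _ = ∑ x, ((∏ j, q (w j)) * (1 + (nIn S w : ℝ))⁻¹) * if x ∈ S then q x * k x else 0 := by
        refine Finset.sum_congr rfl fun x _ => ?_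
        have hn : nIn S (Fin.insertNthEquiv (fun _ => Ω) i (x, w)) =
            (if x ∈ S then 1 else 0) + nIn S w := nIn_insertNth S i x w
        rw [Fin.prod_univ_succAbove _ i]
        simp only [hn]
        simp only [Fin.insertNthEquiv_apply, Fin.insertNth_apply_same,
          Fin.insertNth_apply_succAbove]
        split_ifs
        · push_cast
          ring
        · simp
    _ = 0 := by
        rw [← Finset.mul_sum, Finset.sum_ite_mem, Finset.univ_inter, hk, mul_zero]

/-- The event `n(S) = 0` has probability `q(Sᶜ) ^ n`. -/
theorem iidExp_ite_nIn_eq_zero {Ω : Type*} [Fintype Ω] [DecidableEq Ω] (S : Finset Ω)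
    (q : Ω → ℝ) (n : ℕ) :
    iidExp n q (fun v => if nIn S v = 0 then 1 else 0) = (∑ x ∈ Sᶜ, q x) ^ n := by
  have h : ∑ x ∈ Sᶜ, q x = ∑ x, if x ∈ S then 0 else q x := by
    simp [Finset.sum_ite, Finset.compl_eq_univ_sdiff, Finset.sdiff_eq_filter]
  rw [h, Fintype.sum_pow]
  refine Finset.sum_congr rfl fun v _ => ?_
  by_cases hv : nIn S v = 0
  · have hv' : ∀ i, v i ∉ S := by simpa [nIn, Finset.filter_eq_empty_iff] using hv
    simp [hv, hv']
  · obtain ⟨i, hi⟩ : ∃ i, v i ∈ S := by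
      simpa [nIn, Finset.filter_eq_empty_iff] using hv
    simp only [if_neg hv, mul_zero]
    symm
    exact Finset.prod_eq_zero (Finset.mem_univ i) (if_pos hi)

/-- `F̂(S)` splits into a centred part and `G(S) · c` on the event `n(S) > 0`. -/
theorem kdis_eq_add {Ω : Type*} [Fintype Ω] [DecidableEq Ω] (S : Finset Ω) (f g : Ω → ℝ)
    (c : ℝ) {n : ℕ} (v : Fin n → Ω) :
    kdis S f g v = (∑ s ∈ S, g s) *
      (∑ i, (nIn S v : ℝ)⁻¹ * (if v i ∈ S then f (v i) / g (v i) - c else 0)) +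
      (∑ s ∈ S, g s) * c * (1 - if nIn S v = 0 then 1 else 0) := by
  rw [← Finset.mul_sum, ← Finset.sum_filter, Finset.sum_sub_distrib, Finset.sum_const,
    nsmul_eq_mul]
  change _ = _ * (_ * (_ - (nIn S v : ℝ) * c)) + _
  unfold kdis
  obtain h | h := Nat.eq_zero_or_pos (nIn S v)
  · simp [h]
  · have h0 : (nIn S v : ℝ) ≠ 0 := by exact_mod_cast h.ne'
    rw [if_pos h, if_neg h.ne']
    field_simp
    ring

/-- **Claim: bias of k-DISCount.**
With `F̂(S)` the k-DISCount estimator based on `n` i.i.d. samples from `ḡ_Ω` and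
`p(S) = G(S)/G(Ω)`, the unconditional expectation satisfies
`E[F̂(S)] = (1 − (1 − p(S))ⁿ) · F(S)`; equivalently the bias is
`E[F̂(S)] − F(S) = −F(S) · (1 − p(S))ⁿ`. -/
theorem kdiscount_bias
    (S : Finset Ω) (hS : S.Nonempty) (f g : Ω → ℝ)
    (hf : ∀ s, 0 ≤ f s) (hg : ∀ s, 0 < g s)
    (n : ℕ) (q : Ω → ℝ) (hq : q = fun s => g s / ∑ t, g t)
    (p : ℝ) (hp : p = (∑ s ∈ S, g s) / ∑ s, g s) :
    iidExp n q (fun v => kdis S f g v) = (1 - (1 - p) ^ n) * ∑ s ∈ S, f s ∧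
    iidExp n q (fun v => kdis S f g v) - (∑ s ∈ S, f s)
      = -(∑ s ∈ S, f s) * (1 - p) ^ n := by
  obtain ⟨s₀, hs₀⟩ := hS
  have hGS : 0 < ∑ s ∈ S, g s := Finset.sum_pos (fun s _ => hg s) ⟨s₀, hs₀⟩
  have hG : 0 < ∑ s, g s := Finset.sum_pos (fun s _ => hg s) ⟨s₀, Finset.mem_univ _⟩
  have hq1 : ∑ s, q s = 1 := by
    rw [hq, ← Finset.sum_div, div_self hG.ne']
  have hqS : ∑ s ∈ S, q s = p := by
    rw [hq, hp, ← Finset.sum_div]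
  have hqc : ∑ s ∈ Sᶜ, q s = 1 - p := by
    linarith [Finset.sum_add_sum_compl S q]
  set c : ℝ := (∑ s ∈ S, f s) / ∑ s ∈ S, g s with hc
  have hk : ∑ x ∈ S, q x * (f x / g x - c) = 0 := by
    have h : ∀ x ∈ S, q x * (f x / g x - c) = (f x - c * g x) / ∑ t, g t := by
      intro x _
      have := (hg x).ne'
      rw [hq]
      field_simp
    rw [Finset.sum_congr rfl h, ← Finset.sum_div, Finset.sum_sub_distrib, ← Finset.mul_sum, hc,
      div_mul_cancel₀ _ hGS.ne', sub_self, zero_div]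
  have hcentred : ∑ v : Fin n → Ω, (∏ i, q (v i)) *
      ∑ i, (nIn S v : ℝ)⁻¹ * (if v i ∈ S then f (v i) / g (v i) - c else 0) = 0 := by
    simp_rw [Finset.mul_sum]
    rw [Finset.sum_comm]
    exact Finset.sum_eq_zero fun i _ =>
      iidExp_inv_nIn_mul_eq_zero S q (fun x => f x / g x - c) hk i
  have htotal : ∑ v : Fin n → Ω, ∏ i, q (v i) = 1 := by
    rw [← Fintype.sum_pow, hq1, one_pow]
  have hzero := iidExp_ite_nIn_eq_zero S q n
  rw [hqc] at hzero
  have key : iidExp n q (fun v => kdis S f g v) = (1 - (1 - p) ^ n) * ∑ s ∈ S, f s := by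
    calc iidExp n q (fun v => kdis S f g v)
        = (∑ s ∈ S, g s) * (∑ v : Fin n → Ω, (∏ i, q (v i)) *
            ∑ i, (nIn S v : ℝ)⁻¹ * (if v i ∈ S then f (v i) / g (v i) - c else 0)) +
          (∑ s ∈ S, g s) * c * (∑ v : Fin n → Ω, ∏ i, q (v i) -
            iidExp n q (fun v => if nIn S v = 0 then 1 else 0)) := by
          unfold iidExp
          rw [← Finset.sum_sub_distrib, Finset.mul_sum, Finset.mul_sum, ← Finset.sum_add_distrib]
          refine Finset.sum_congr rfl fun v _ => ?_
          simp only [kdis_eq_add S f g c v]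
          ring
      _ = (1 - (1 - p) ^ n) * ∑ s ∈ S, f s := by
          rw [hcentred, htotal, hzero, hc, mul_div_cancel₀ _ hGS.ne']
          ring
  exact ⟨key, by rw [key]; ring⟩
end
end
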